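/- arXiv:1704.03854 — 2 statements merged into one kernel-verified Lean document; each statement's English description precedes it below -/
import Mathlib

section
/- Let ε > 0, κ ∈ ℝ, 0 < t₁ < 1, and let a(t) = −t^{1/ε}·log t. If (0 < ε < 1 and κ > 0), or ε ≥ 1, or κ = 0, then lim_{t→0⁺} ∫_t^{t₁} a(s) ∫_s^{t₁} (1/a(u))·(a''(u)/a(u) − a'(u)²/a(u)² − κ/a(u)²) du ds = −∞. -/
open Filter Topology Set MeasureTheory intervalIntegral

lemma tendsto_integral_atBot_of_le_sub_div {h : ℝ → ℝ} {δ b M c : ℝ} (hδ : 0 < δ) (hδb : δ ≤ b)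
    (hc : 0 < c) (hh : ContinuousOn h (Ioc 0 b)) (hle : ∀ s ∈ Ioc 0 δ, h s ≤ M - c / s) :
    Tendsto (fun t => ∫ s in t..b, h s) (𝓝[>] (0 : ℝ)) atBot := by
  have hint : ∀ x y, 0 < x → x ≤ y → y ≤ b → IntervalIntegrable h volume x y := by
    intro x y hx hxy hy
    refine ContinuousOn.intervalIntegrable_of_Icc hxy (hh.mono ?_)
    intro u hu
    exact ⟨hx.trans_le hu.1, hu.2.trans hy⟩
  have hbound : ∀ᶠ t in 𝓝[>] (0 : ℝ), ∫ s in t..b, h s ≤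
      (|M| * δ + (∫ s in δ..b, h s) - c * Real.log δ) + c * Real.log t := by
    filter_upwards [Ioo_mem_nhdsGT hδ] with t ht
    have hsplit := integral_add_adjacent_intervals (hint t δ ht.1 ht.2.le hδb)
      (hint δ b hδ hδb le_rfl)
    have hinv : IntervalIntegrable (fun s : ℝ => c * s⁻¹) volume t δ := by
      refine ContinuousOn.intervalIntegrable_of_Icc ht.2.le ?_
      refine continuousOn_const.mul (continuousOn_inv₀.mono ?_)
      intro u hu
      exact (ht.1.trans_le hu.1).ne'
    have hmono : ∫ s in t..δ, h s ≤ ∫ s in t..δ, (M - c * s⁻¹) := by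
      refine integral_mono_on ht.2.le (hint t δ ht.1 ht.2.le hδb)
        (intervalIntegrable_const.sub hinv) ?_
      intro s hs
      simpa [div_eq_mul_inv] using hle s ⟨ht.1.trans_le hs.1, hs.2⟩
    rw [integral_sub intervalIntegrable_const hinv, intervalIntegral.integral_const,
      intervalIntegral.integral_const_mul, integral_inv_of_pos ht.1 hδ,
      Real.log_div hδ.ne' ht.1.ne', smul_eq_mul] at hmono
    have hM : (δ - t) * M ≤ |M| * δ := by
      calc (δ - t) * M ≤ (δ - t) * |M| :=
            mul_le_mul_of_nonneg_left (le_abs_self M) (by linarith [ht.2])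
        _ ≤ |M| * δ := by nlinarith [abs_nonneg M, ht.1]
    linarith
  refine tendsto_atBot_mono' _ hbound ?_
  exact tendsto_atBot_add_const_left _ _ (Real.tendsto_log_nhdsGT_zero.const_mul_atBot hc)

lemma neg_rpow_mul_log_pos (p : ℝ) {u : ℝ} (h0 : 0 < u) (h1 : u < 1) :
    0 < -(u ^ p) * Real.log u :=
  mul_pos_of_neg_of_neg (neg_neg_of_pos (Real.rpow_pos_of_pos h0 p)) (Real.log_neg h0 h1)

lemma hasDerivAt_neg_rpow_mul_log (p : ℝ) {u : ℝ} (h0 : 0 < u) (h1 : u < 1) :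
    HasDerivAt (fun u => -(u ^ p) * Real.log u)
      (-(u ^ p) * Real.log u * (p / u + 1 / (u * Real.log u))) u := by
  have hl : Real.log u ≠ 0 := (Real.log_neg h0 h1).ne
  have h := ((Real.hasDerivAt_rpow_const (p := p) (Or.inl h0.ne')).neg).mul
    (Real.hasDerivAt_log h0.ne')
  refine h.congr_deriv ?_
  simp only [Pi.neg_apply]
  rw [Real.rpow_sub_one h0.ne']
  field_simp
  ring

lemma hasDerivAt_div_add_one_div_mul_log (p : ℝ) {u : ℝ} (h0 : 0 < u) (h1 : u < 1) :
    HasDerivAt (fun u => p / u + 1 / (u * Real.log u))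
      ((-p - 1 / Real.log u - 1 / Real.log u ^ 2) / u ^ 2) u := by
  have hl : Real.log u ≠ 0 := (Real.log_neg h0 h1).ne
  have h := ((hasDerivAt_const u p).div (hasDerivAt_id u) h0.ne').add
    ((hasDerivAt_const u (1 : ℝ)).div ((hasDerivAt_id u).mul (Real.hasDerivAt_log h0.ne'))
      (mul_ne_zero h0.ne' hl))
  refine h.congr_deriv ?_
  simp
  field_simp
  ring

lemma deriv_deriv_div_sub_sq_neg_rpow_mul_log (p : ℝ) {u : ℝ} (h0 : 0 < u) (h1 : u < 1)
    {a : ℝ → ℝ} (ha : a = fun u => -(u ^ p) * Real.log u) :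
    deriv (deriv a) u / a u - (deriv a u) ^ 2 / (a u) ^ 2 =
      (-p - 1 / Real.log u - 1 / Real.log u ^ 2) / u ^ 2 := by
  have hda : ∀ v, 0 < v → v < 1 →
      HasDerivAt a (a v * (p / v + 1 / (v * Real.log v))) v := by
    intro v hv0 hv1
    subst ha
    exact hasDerivAt_neg_rpow_mul_log p hv0 hv1
  have hev : deriv a =ᶠ[𝓝 u] fun v => a v * (p / v + 1 / (v * Real.log v)) := by
    filter_upwards [Ioo_mem_nhds h0 h1] with v hv
    exact (hda v hv.1 hv.2).deriv
  have hpos : a u ≠ 0 := by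
    subst ha
    exact (neg_rpow_mul_log_pos p h0 h1).ne'
  have hdd := ((hda u h0 h1).mul (hasDerivAt_div_add_one_div_mul_log p h0 h1)).deriv
  rw [hev.deriv_eq, (hda u h0 h1).deriv, ← Pi.mul_def, hdd]
  generalize p / u + 1 / (u * Real.log u) = H
  generalize (-p - 1 / Real.log u - 1 / Real.log u ^ 2) / u ^ 2 = K
  field_simp
  ring

lemma eventually_integrand_le {p κ : ℝ} (hp : 0 < p) (hκ : 0 ≤ κ ∨ p ≤ 1) :
    ∀ᶠ u in 𝓝[>] (0 : ℝ), 1 / (-(u ^ p) * Real.log u) *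
      ((-p - 1 / Real.log u - 1 / Real.log u ^ 2) / u ^ 2 - κ / (-(u ^ p) * Real.log u) ^ 2) ≤
      -(p / 2) * (u ^ (-(p + 2)) / -Real.log u) := by
  have hlog := Real.tendsto_log_nhdsGT_zero.eventually
    (eventually_le_atBot (-(4 / p + 4 * |κ| / p + 1)))
  filter_upwards [Ioo_mem_nhdsGT (zero_lt_one' ℝ), hlog] with u hu hL
  obtain ⟨h0, h1⟩ := hu
  have hA := neg_rpow_mul_log_pos p h0 h1
  have hrp := Real.rpow_pos_of_pos h0 p
  set L := -Real.log u with hLdef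
  have hlogL : Real.log u = -L := by simp [hLdef]
  have hq1 : 0 < 4 / p := by positivity
  have hq2 : 0 ≤ 4 * |κ| / p := by positivity
  have hL1 : 1 ≤ L := by linarith
  have hL0 : 0 < L := by linarith
  have hLp : 1 / L ≤ p / 4 := by
    rw [div_le_div_iff₀ hL0 (by norm_num)]
    have : 4 / p ≤ L := by linarith
    rw [div_le_iff₀ hp] at this
    linarith
  have hLκ : |κ| ≤ p / 4 * L ^ 2 := by
    have : 4 * |κ| / p ≤ L := by linarith
    rw [div_le_iff₀ hp] at this
    nlinarith [mul_nonneg hp.le (mul_nonneg hL0.le (sub_nonneg.2 hL1))]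
  have hκle : -κ / (u ^ p * L) ^ 2 ≤ p / 4 / u ^ 2 := by
    rcases hκ with hκ | hp1
    · exact (div_nonpos_of_nonpos_of_nonneg (by linarith) (by positivity)).trans (by positivity)
    · have hup : u ≤ u ^ p := by
        simpa using Real.rpow_le_rpow_of_exponent_ge h0 h1.le hp1
      rw [div_le_div_iff₀ (by positivity) (by positivity)]
      have husq : u ^ 2 ≤ (u ^ p) ^ 2 := by gcongr
      calc -κ * u ^ 2 ≤ |κ| * u ^ 2 := by gcongr; exact neg_le_abs κ
        _ ≤ (p / 4 * L ^ 2) * (u ^ p) ^ 2 := by gcongr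
        _ = p / 4 * (u ^ p * L) ^ 2 := by ring
  have hpow : u ^ (-(p + 2)) = 1 / (u ^ p * u ^ 2) := by
    rw [Real.rpow_neg h0.le, Real.rpow_add h0, Real.rpow_two, one_div]
  rw [hlogL, hpow, neg_mul_neg]
  have hmain : (-p - 1 / -L - 1 / (-L) ^ 2) / u ^ 2 - κ / (u ^ p * L) ^ 2 ≤ -(p / 2) / u ^ 2 := by
    have h2 : (-p - 1 / -L - 1 / (-L) ^ 2) / u ^ 2 ≤ (-p + p / 4) / u ^ 2 := by
      have : 0 ≤ 1 / (-L) ^ 2 := by positivity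
      gcongr
      rw [div_neg]
      linarith
    have h3 : (-p + p / 4) / u ^ 2 + p / 4 / u ^ 2 = -(p / 2) / u ^ 2 := by ring
    have h4 : -κ / (u ^ p * L) ^ 2 = -(κ / (u ^ p * L) ^ 2) := by ring
    linarith
  calc _ ≤ 1 / (u ^ p * L) * (-(p / 2) / u ^ 2) := by gcongr
    _ = _ := by field_simp

lemma mul_integral_rpow_div_neg_log_ge {p s δ : ℝ} (hp : 0 < p) (h0 : 0 < s) (hs : s ≤ δ)
    (hδ : δ < 1) :
    1 / (p + 1) / s - δ ^ (-(p + 1)) / (p + 1) ≤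
      -(s ^ p) * Real.log s * ∫ u in s..δ, u ^ (-(p + 2)) / -Real.log u := by
  have hL : 0 < -Real.log s := neg_pos.2 (Real.log_neg h0 (hs.trans_lt hδ))
  have hrpc : ContinuousOn (fun u : ℝ => u ^ (-(p + 2))) (Icc s δ) :=
    continuousOn_id.rpow_const fun u hu => Or.inl (h0.trans_le hu.1).ne'
  have hlogc : ContinuousOn (fun u : ℝ => -Real.log u) (Icc s δ) :=
    (Real.continuousOn_log.mono fun u hu => (h0.trans_le hu.1).ne').neg
  have hmono : ∫ u in s..δ, u ^ (-(p + 2)) / -Real.log s ≤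
      ∫ u in s..δ, u ^ (-(p + 2)) / -Real.log u := by
    refine integral_mono_on hs
      ((hrpc.div_const _).intervalIntegrable_of_Icc hs)
      ((hrpc.div hlogc fun u hu => ?_).intervalIntegrable_of_Icc hs) fun u hu => ?_
    · exact (neg_pos.2 (Real.log_neg (h0.trans_le hu.1) (hu.2.trans_lt hδ))).ne'
    · have hu0 := h0.trans_le hu.1
      refine div_le_div_of_nonneg_left (Real.rpow_nonneg hu0.le _)
        (neg_pos.2 (Real.log_neg hu0 (hu.2.trans_lt hδ))) ?_
      exact neg_le_neg (Real.log_le_log h0 hu.1)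
  have hval : ∫ u in s..δ, u ^ (-(p + 2)) / -Real.log s =
      (s ^ (-(p + 1)) - δ ^ (-(p + 1))) / (p + 1) / -Real.log s := by
    rw [intervalIntegral.integral_div, integral_rpow]
    · have : -(p + 2) + 1 = -(p + 1) := by ring
      rw [this, ← neg_sub, neg_div_neg_eq]
    · refine Or.inr ⟨by linarith, ?_⟩
      rw [uIcc_of_le hs]
      exact fun h => (h0.trans_le h.1).false
  have hsp : s ^ p * s ^ (-(p + 1)) = 1 / s := by
    rw [← Real.rpow_add h0]
    have : p + -(p + 1) = -1 := by ring
    rw [this, Real.rpow_neg_one, one_div]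
  have hsp1 : s ^ p ≤ 1 := Real.rpow_le_one h0.le (hs.trans hδ.le) hp.le
  have hδp : 0 ≤ δ ^ (-(p + 1)) := Real.rpow_nonneg (h0.le.trans hs) _
  calc 1 / (p + 1) / s - δ ^ (-(p + 1)) / (p + 1)
      = (1 / s - 1 * δ ^ (-(p + 1))) / (p + 1) := by field_simp
    _ ≤ (1 / s - s ^ p * δ ^ (-(p + 1))) / (p + 1) := by gcongr
    _ = -(s ^ p) * Real.log s * ((s ^ (-(p + 1)) - δ ^ (-(p + 1))) / (p + 1) / -Real.log s) := by
        rw [← hsp]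
        have : Real.log s ≠ 0 := by linarith
        field_simp
    _ ≤ _ := by
        rw [← hval]
        exact mul_le_mul_of_nonneg_left hmono
          (neg_rpow_mul_log_pos p h0 (hs.trans_lt hδ)).le

/-- Paper's verification that condition (33) of its main theorem holds for the
logarithmically corrected scale factor `a(t) = -t^(1/ε) * log t` in the listed
cases. -/
theorem log_corrected_condition33
    (ε : ℝ) (hε : 0 < ε) (κ t₁ : ℝ) (ht₁0 : 0 < t₁) (ht₁1 : t₁ < 1)
    (a : ℝ → ℝ) (ha : a = fun u => -(u ^ (1 / ε)) * Real.log u)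
    (hcase : (0 < ε ∧ ε < 1 ∧ 0 < κ) ∨ 1 ≤ ε ∨ κ = 0) :
    Tendsto (fun t => ∫ s in t..t₁, a s * ∫ u in s..t₁,
        (1 / a u) * (deriv (deriv a) u / a u - (deriv a u) ^ 2 / (a u) ^ 2
          - κ / (a u) ^ 2))
      (𝓝[>] (0 : ℝ)) atBot := by
  have hp : 0 < 1 / ε := by positivity
  have hκ : 0 ≤ κ ∨ 1 / ε ≤ 1 := by
    rcases hcase with h | h | h
    · exact Or.inl h.2.2.le
    · exact Or.inr ((div_le_one hε).2 h)
    · exact Or.inl h.ge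
  generalize 1 / ε = p at *
  set f : ℝ → ℝ := fun u => (1 / a u) * (deriv (deriv a) u / a u - (deriv a u) ^ 2 / (a u) ^ 2
          - κ / (a u) ^ 2) with hf
  have hau : ∀ u, a u = -(u ^ p) * Real.log u := fun u => by rw [ha]
  have hapos : ∀ u ∈ Ioo (0 : ℝ) 1, 0 < a u := fun u hu => by
    rw [hau]; exact neg_rpow_mul_log_pos p hu.1 hu.2
  have hfeq : ∀ u ∈ Ioo (0 : ℝ) 1, f u = 1 / a u *
      ((-p - 1 / Real.log u - 1 / Real.log u ^ 2) / u ^ 2 - κ / a u ^ 2) := fun u hu => by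
    rw [hf]
    simp only
    rw [deriv_deriv_div_sub_sq_neg_rpow_mul_log p hu.1 hu.2 ha]
  have hac : ContinuousOn a (Ioo 0 1) := fun u hu => by
    rw [ha]
    exact (hasDerivAt_neg_rpow_mul_log p hu.1 hu.2).continuousAt.continuousWithinAt
  have hlogc : ContinuousOn Real.log (Ioo 0 1) :=
    Real.continuousOn_log.mono fun u hu => hu.1.ne'
  have hlog0 : ∀ u ∈ Ioo (0 : ℝ) 1, Real.log u ≠ 0 := fun u hu => (Real.log_neg hu.1 hu.2).ne
  have hfc : ContinuousOn f (Ioo 0 1) := by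
    refine ContinuousOn.congr ?_ hfeq
    refine (continuousOn_const.div hac fun u hu => (hapos u hu).ne').mul (ContinuousOn.sub
      (ContinuousOn.div ((continuousOn_const.sub (continuousOn_const.div hlogc hlog0)).sub
        (continuousOn_const.div (hlogc.pow 2) fun u hu => pow_ne_zero 2 (hlog0 u hu)))
        (continuousOn_id.pow 2) fun u hu => pow_ne_zero 2 hu.1.ne')
      (continuousOn_const.div (hac.pow 2) fun u hu => pow_ne_zero 2 (hapos u hu).ne'))
  have hfint : ∀ x ∈ Ioo (0 : ℝ) 1, ∀ y ∈ Ioo (0 : ℝ) 1, IntervalIntegrable f volume x y :=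
    fun x hx y hy => (hfc.mono (ordConnected_Ioo.uIcc_subset hx hy)).intervalIntegrable
  have ht₁ : t₁ ∈ Ioo (0 : ℝ) 1 := ⟨ht₁0, ht₁1⟩
  have hFc : ContinuousOn (fun s => ∫ u in s..t₁, f u) (Ioo 0 1) := fun s hs => by
    have hd := integral_hasDerivAt_left (hfint s hs t₁ ht₁)
      (hfc.stronglyMeasurableAtFilter isOpen_Ioo s hs)
      (hfc.continuousAt (isOpen_Ioo.mem_nhds hs))
    exact hd.continuousAt.continuousWithinAt
  have ha1 : ∀ᶠ u in 𝓝[>] (0 : ℝ), a u ≤ 1 := by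
    have h := (tendsto_log_mul_rpow_nhdsGT_zero hp).neg
    rw [neg_zero] at h
    filter_upwards [h.eventually (eventually_le_nhds (zero_lt_one' ℝ))] with u hu
    rw [hau]
    linarith
  obtain ⟨d, hd0, hd⟩ := mem_nhdsGT_iff_exists_Ioc_subset.1
    (ha1.and (eventually_integrand_le hp hκ))
  obtain ⟨δ, hδ0, hδd, hδt⟩ : ∃ δ, 0 < δ ∧ δ ≤ d ∧ δ ≤ t₁ :=
    ⟨min d t₁, lt_min hd0 ht₁0, min_le_left _ _, min_le_right _ _⟩
  have hδ1 : δ < 1 := hδt.trans_lt ht₁1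
  refine tendsto_integral_atBot_of_le_sub_div
    (M := |∫ u in δ..t₁, f u| + p / 2 * (δ ^ (-(p + 1)) / (p + 1)))
    (c := p / 2 * (1 / (p + 1))) hδ0 hδt (by positivity)
    ((hac.mul hFc).mono fun u hu => ⟨hu.1, hu.2.trans_lt ht₁1⟩) fun s hs => ?_
  have hs1 : s ∈ Ioo (0 : ℝ) 1 := ⟨hs.1, hs.2.trans_lt hδ1⟩
  have hsub : Icc s δ ⊆ Ioo 0 1 := fun u hu => ⟨hs.1.trans_le hu.1, hu.2.trans_lt hδ1⟩
  have hgint : IntervalIntegrable (fun u => -(p / 2) * (u ^ (-(p + 2)) / -Real.log u))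
      volume s δ := by
    refine ContinuousOn.intervalIntegrable_of_Icc hs.2 (continuousOn_const.mul
      (ContinuousOn.div ?_ (hlogc.mono hsub).neg fun u hu => neg_ne_zero.2 (hlog0 u (hsub hu))))
    exact continuousOn_id.rpow_const fun u hu => Or.inl (hsub hu).1.ne'
  have hmono : ∫ u in s..δ, f u ≤ ∫ u in s..δ, -(p / 2) * (u ^ (-(p + 2)) / -Real.log u) := by
    refine integral_mono_on hs.2 (hfint s hs1 δ ⟨hδ0, hδ1⟩) hgint fun u hu => ?_
    rw [hfeq u (hsub hu), hau]
    exact (hd ⟨(hsub hu).1, hu.2.trans hδd⟩).2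
  rw [intervalIntegral.integral_const_mul] at hmono
  have hlow := mul_integral_rpow_div_neg_log_ge hp hs.1 hs.2 hδ1
  rw [← hau] at hlow
  have has1 : a s ≤ 1 := (hd ⟨hs.1, hs.2.trans hδd⟩).1
  have hsplit := integral_add_adjacent_intervals (hfint s hs1 δ ⟨hδ0, hδ1⟩)
    (hfint δ ⟨hδ0, hδ1⟩ t₁ ht₁)
  have hconst : a s * ∫ u in δ..t₁, f u ≤ |∫ u in δ..t₁, f u| :=
    (mul_le_mul_of_nonneg_left (le_abs_self _) (hapos s hs1).le).trans
      (mul_le_of_le_one_left (abs_nonneg _) has1)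
  have hfirst := mul_le_mul_of_nonneg_left hmono (hapos s hs1).le
  have hscaled := mul_le_mul_of_nonneg_left hlow (by positivity : 0 ≤ p / 2)
  rw [← hsplit, mul_add, mul_div_assoc]
  linarith
end

section
/- Let ε > 0, κ ∈ ℝ, C > 0, let a(t) = −t^{1/ε}·log t for 0 < t < 1, and let f(t) = 3a''(t) + (2C/a(t))·(a''(t)/a(t) − a'(t)²/a(t)² − κ/a(t)²). If (0 < ε < 1 and κ > 0), or ε ≥ 1, or κ = 0, then lim_{t→0⁺} f(t) = −∞. -/
open Filter Topology Set MeasureTheory intervalIntegral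

theorem hasDerivAt_rpow_mul_affine_log (q b c : ℝ) {t : ℝ} (ht : 0 < t) :
    HasDerivAt (fun s : ℝ => s ^ q * (b * Real.log s + c))
      (t ^ (q - 1) * (q * b * Real.log t + (q * c + b))) t := by
  have h := (Real.hasDerivAt_rpow_const (p := q) (Or.inl ht.ne')).mul
    (((Real.hasDerivAt_log ht.ne').const_mul b).add_const c)
  refine h.congr_deriv ?_
  rw [Real.rpow_sub_one ht.ne']
  field_simp
  ring

theorem deriv_neg_rpow_mul_log (p : ℝ) {t : ℝ} (ht : 0 < t) :
    deriv (fun s : ℝ => -(s ^ p) * Real.log s) t = t ^ (p - 1) * (-p * Real.log t + -1) := by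
  have h := (hasDerivAt_rpow_mul_affine_log p (-1) 0 ht).deriv
  have e : (fun s : ℝ => -(s ^ p) * Real.log s)
      = fun s : ℝ => s ^ p * (-1 * Real.log s + 0) := by
    funext s
    ring
  rw [e, h]
  ring

theorem deriv_deriv_neg_rpow_mul_log (p : ℝ) {t : ℝ} (ht : 0 < t) :
    deriv (deriv (fun s : ℝ => -(s ^ p) * Real.log s)) t
      = t ^ (p - 2) * (-(p * (p - 1)) * Real.log t - (2 * p - 1)) := by
  have e : deriv (fun s : ℝ => -(s ^ p) * Real.log s)
      =ᶠ[𝓝 t] fun s : ℝ => s ^ (p - 1) * (-p * Real.log s + -1) := by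
    filter_upwards [Ioi_mem_nhds ht] with s hs
    exact deriv_neg_rpow_mul_log p hs
  rw [e.deriv_eq, (hasDerivAt_rpow_mul_affine_log (p - 1) (-p) (-1) ht).deriv,
    show p - 1 - 1 = p - 2 by ring]
  ring

/-- Paper's verification (Eqs. 66–67) that for the logarithmically corrected
scale factor `a(t) = -t^(1/ε) * log t` in the listed cases, the function `f`
of its main theorem tends to `-∞` at the singularity. -/
theorem log_corrected_f_tendsto_atBot
    (ε : ℝ) (hε : 0 < ε) (κ C : ℝ) (hC : 0 < C)
    (a : ℝ → ℝ) (ha : a = fun t => -(t ^ (1 / ε)) * Real.log t)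
    (f : ℝ → ℝ)
    (hf : ∀ t, f t = 3 * deriv (deriv a) t
      + (2 * C / a t) * (deriv (deriv a) t / a t - (deriv a t) ^ 2 / (a t) ^ 2
          - κ / (a t) ^ 2))
    (hcase : (0 < ε ∧ ε < 1 ∧ 0 < κ) ∨ 1 ≤ ε ∨ κ = 0) :
    Tendsto f (𝓝[>] (0 : ℝ)) atBot := by
  have hp : 0 < 1 / ε := by positivity
  have hcase' : 0 ≤ κ ∨ 1 / ε ≤ 1 := by
    rcases hcase with h | h | h
    · exact Or.inl h.2.2.le
    · exact Or.inr ((div_le_one hε).2 h)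
    · exact Or.inl h.ge
  generalize 1 / ε = p at *
  have hT : Tendsto (fun t : ℝ => t ^ p) (𝓝[>] (0 : ℝ)) (𝓝 0) := by
    have h := (Real.continuousAt_rpow_const 0 p (Or.inr hp.le)).tendsto
    rw [Real.zero_rpow hp.ne'] at h
    exact h.mono_left nhdsWithin_le_nhds
  have hA : Tendsto (fun t : ℝ => Real.log t * t ^ p) (𝓝[>] (0 : ℝ)) (𝓝 0) :=
    tendsto_log_mul_rpow_nhdsGT_zero hp
  have hu : Tendsto (fun t : ℝ => (Real.log t)⁻¹) (𝓝[>] (0 : ℝ)) (𝓝 0) :=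
    tendsto_inv_atBot_zero.comp Real.tendsto_log_nhdsGT_zero
  have hmem : ∀ᶠ t : ℝ in 𝓝[>] (0 : ℝ), 0 < t ∧ t < 1 :=
    Ioo_mem_nhdsGT one_pos
  have hP : Tendsto (fun t : ℝ => (-(Real.log t * t ^ (p + 2)))⁻¹) (𝓝[>] (0 : ℝ)) atTop := by
    refine tendsto_inv_nhdsGT_zero.comp (tendsto_nhdsWithin_iff.2 ⟨?_, ?_⟩)
    · simpa using (tendsto_log_mul_rpow_nhdsGT_zero (by linarith : 0 < p + 2)).neg
    · filter_upwards [hmem] with t ht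
      exact neg_pos.2 (mul_neg_of_neg_of_pos (Real.log_neg ht.1 ht.2) (Real.rpow_pos_of_pos ht.1 _))
  have hh : Tendsto (fun t : ℝ =>
      3 * (p * (p - 1) * (Real.log t * t ^ p) ^ 2
        + (2 * p - 1) * (t ^ p * (Real.log t * t ^ p)))
      - 2 * C * (p + (Real.log t)⁻¹ + (Real.log t)⁻¹ ^ 2)
      + 2 * C * |κ| * (Real.log t)⁻¹ ^ 2) (𝓝[>] (0 : ℝ)) (𝓝 (-(2 * C * p))) := by
    have h := (((((hA.pow 2).const_mul (p * (p - 1))).add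
      ((hT.mul hA).const_mul (2 * p - 1))).const_mul 3).sub
      (((hu.const_add p).add (hu.pow 2)).const_mul (2 * C))).add
      ((hu.pow 2).const_mul (2 * C * |κ|))
    convert h using 2
    ring
  have hneg : -(2 * C * p) < 0 := by
    have : 0 < C * p := mul_pos hC hp
    linarith
  refine tendsto_atBot_mono' _ ?_ (hP.atTop_mul_neg hneg hh)
  filter_upwards [hmem] with t ⟨ht0, ht1⟩
  have hL : Real.log t < 0 := Real.log_neg ht0 ht1
  have hκ : -κ * t ^ (2 - 2 * p) ≤ |κ| := by
    have hpow : 0 < t ^ (2 - 2 * p) := Real.rpow_pos_of_pos ht0 _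
    rcases hcase' with h | h
    · nlinarith [abs_nonneg κ, mul_nonneg h hpow.le]
    · have h1 : t ^ (2 - 2 * p) ≤ 1 := Real.rpow_le_one ht0.le ht1.le (by linarith)
      nlinarith [neg_le_abs κ, abs_nonneg κ]
  have hpos : 0 < (-(Real.log t * t ^ (p + 2)))⁻¹ :=
    inv_pos.2 (neg_pos.2 (mul_neg_of_neg_of_pos hL (Real.rpow_pos_of_pos ht0 _)))
  have hft : f t = (-(Real.log t * t ^ (p + 2)))⁻¹ *
      (3 * (p * (p - 1) * (Real.log t * t ^ p) ^ 2
        + (2 * p - 1) * (t ^ p * (Real.log t * t ^ p)))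
      - 2 * C * (p + (Real.log t)⁻¹ + (Real.log t)⁻¹ ^ 2)
      + 2 * C * (-κ * t ^ (2 - 2 * p)) * (Real.log t)⁻¹ ^ 2) := by
    have hTpos : 0 < t ^ p := Real.rpow_pos_of_pos ht0 p
    have e1 : t ^ (p + 2) = t ^ p * t ^ 2 := by
      rw [Real.rpow_add ht0, Real.rpow_two]
    have e2 : t ^ (p - 2) = t ^ p / t ^ 2 := by
      rw [Real.rpow_sub ht0, Real.rpow_two]
    have e3 : t ^ (2 - 2 * p) = t ^ 2 / (t ^ p) ^ 2 := by
      rw [Real.rpow_sub ht0, Real.rpow_two, mul_comm, Real.rpow_mul ht0.le, Real.rpow_two]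
    rw [hf, ha, deriv_deriv_neg_rpow_mul_log p ht0, deriv_neg_rpow_mul_log p ht0,
      Real.rpow_sub_one ht0.ne', e1, e2, e3]
    beta_reduce
    have hL0 := hL.ne
    generalize Real.log t = L at hL0 ⊢
    generalize t ^ p = T at hTpos ⊢
    field_simp
    ring
  rw [hft]
  gcongr
end
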